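/- If in the prime factorization of a positive integer n, every prime other than 3 that is not congruent to 1 modulo 6 occurs with an even exponent, then n is a B-number. -/

import Mathlib

/-- The integers represented by the quadratic form `a² + ab + b²`, which are closed under
multiplication. -/
def loeschianSubmonoid : Submonoid ℤ where
  carrier := {n | ∃ a b : ℤ, n = a ^ 2 + a * b + b ^ 2}
  one_mem' := ⟨1, 0, by norm_num⟩
  mul_mem' := by
    rintro _ _ ⟨a, b, rfl⟩ ⟨c, d, rfl⟩
    exact ⟨a * c - b * d, a * d + b * c + b * d, by ring⟩

theorem three_mem_loeschianSubmonoid : 3 ∈ loeschianSubmonoid :=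
  ⟨1, 1, by norm_num⟩

theorem sq_mem_loeschianSubmonoid (n : ℤ) : n ^ 2 ∈ loeschianSubmonoid :=
  ⟨n, 0, by ring⟩

theorem exists_nat_of_mem_loeschianSubmonoid {n : ℕ} (hn : (n : ℤ) ∈ loeschianSubmonoid) :
    ∃ a b : ℕ, n = a ^ 2 + a * b + b ^ 2 := by
  have of_nonneg {a b : ℤ} (ha : 0 ≤ a) (hb : 0 ≤ b) (h : (n : ℤ) = a ^ 2 + a * b + b ^ 2) :
      ∃ a b : ℕ, n = a ^ 2 + a * b + b ^ 2 := by
    lift a to ℕ using ha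
    lift b to ℕ using hb
    exact ⟨a, b, by exact_mod_cast h⟩
  have of_nonneg_nonpos {a b : ℤ} (ha : 0 ≤ a) (hb : b ≤ 0)
      (h : (n : ℤ) = a ^ 2 + a * b + b ^ 2) : ∃ a b : ℕ, n = a ^ 2 + a * b + b ^ 2 := by
    rcases le_total 0 (a + b) with hab | hab
    · exact of_nonneg hab (neg_nonneg.2 hb) (by rw [h]; ring)
    · exact of_nonneg ha (neg_nonneg.2 hab) (by rw [h]; ring)
  obtain ⟨a, b, h⟩ := hn
  rcases le_total 0 a with ha | ha <;> rcases le_total 0 b with hb | hb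
  · exact of_nonneg ha hb h
  · exact of_nonneg_nonpos ha hb h
  · exact of_nonneg_nonpos hb ha (by rw [h]; ring)
  · exact of_nonneg (neg_nonneg.2 ha) (neg_nonneg.2 hb) (by rw [h]; ring)

theorem ZMod.exists_sq_add_self_add_one_eq_zero {p : ℕ} [Fact p.Prime] (hp : p % 3 = 1) :
    ∃ x : ZMod p, x ^ 2 + x + 1 = 0 := by
  have hdvd : 3 ∣ Nat.card (ZMod p)ˣ := by
    rw [Nat.card_eq_fintype_card, ZMod.card_units]
    omega
  obtain ⟨x, hx⟩ := exists_prime_orderOf_dvd_card' 3 hdvd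
  have hx3 : (x : ZMod p) ^ 3 = 1 := by
    rw [← Units.val_pow_eq_pow_val, ← hx, pow_orderOf_eq_one, Units.val_one]
  have hx1 : (x : ZMod p) - 1 ≠ 0 := by
    rw [sub_ne_zero, Ne, Units.val_eq_one]
    rintro rfl
    simp at hx
  exact ⟨x, (mul_eq_zero.1 (by linear_combination hx3 :
    ((x : ZMod p) - 1) * ((x : ZMod p) ^ 2 + x + 1) = 0)).resolve_left hx1⟩

/-- Thue's lemma. -/
theorem ZMod.exists_sq_le_intCast_eq_mul {n : ℕ} [NeZero n] (x : ZMod n) :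
    ∃ u v : ℤ, (u ≠ 0 ∨ v ≠ 0) ∧ u ^ 2 ≤ n ∧ v ^ 2 ≤ n ∧ (u : ZMod n) = x * v := by
  let s := Finset.range (n.sqrt + 1) ×ˢ Finset.range (n.sqrt + 1)
  have hcard : (Finset.univ : Finset (ZMod n)).card < s.card := by
    simpa [s, ZMod.card] using Nat.lt_succ_sqrt n
  obtain ⟨⟨a, b⟩, hab, ⟨c, d⟩, hcd, hne, heq⟩ :=
    Finset.exists_ne_map_eq_of_card_lt_of_maps_to (s := s) hcard
      (f := fun q => (q.1 : ZMod n) - x * q.2) (fun _ _ => Finset.mem_coe.2 (Finset.mem_univ _))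
  have sq_le {k l : ℕ} (hk : k ≤ n.sqrt) (hl : l ≤ n.sqrt) : ((k : ℤ) - l) ^ 2 ≤ n := by
    have h : ((n.sqrt : ℤ)) ^ 2 ≤ n := by exact_mod_cast Nat.sqrt_le' n
    refine (sq_le_sq' ?_ ?_).trans h <;> omega
  simp only [s, Finset.mem_product, Finset.mem_range, Nat.lt_succ_iff] at hab hcd
  refine ⟨a - c, b - d, ?_, sq_le hab.1 hcd.1, sq_le hab.2 hcd.2, ?_⟩
  · by_contra! h
    exact hne (Prod.ext (by dsimp only; omega) (by dsimp only; omega))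
  · push_cast
    linear_combination heq

theorem Nat.Prime.mem_loeschianSubmonoid {p : ℕ} (hp : p.Prime) (h6 : p % 6 = 1) :
    (p : ℤ) ∈ loeschianSubmonoid := by
  have := Fact.mk hp
  obtain ⟨x, hx⟩ := ZMod.exists_sq_add_self_add_one_eq_zero (p := p) (by omega)
  obtain ⟨u, v, hne, hu, hv, huv⟩ := ZMod.exists_sq_le_intCast_eq_mul x
  have ne_sq (w : ℤ) : w ^ 2 ≠ p := fun h =>
    (Nat.prime_iff_prime_int.1 hp).not_isSquare ⟨w, by rw [← h, sq]⟩
  have hu' := lt_of_le_of_ne hu (ne_sq u)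
  have hv' := lt_of_le_of_ne hv (ne_sq v)
  obtain ⟨k, hk⟩ : (p : ℤ) ∣ u ^ 2 + u * v + v ^ 2 := by
    rw [← ZMod.intCast_zmod_eq_zero_iff_dvd]
    push_cast
    rw [huv]
    linear_combination (v : ZMod p) ^ 2 * hx
  have hp0 : (0 : ℤ) < p := by exact_mod_cast hp.pos
  have hpos : 0 < u ^ 2 + u * v + v ^ 2 := by
    rcases hne with h | h
    · nlinarith [sq_pos_of_ne_zero h, sq_nonneg (u + 2 * v)]
    · nlinarith [sq_pos_of_ne_zero h, sq_nonneg (2 * u + v)]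
  have hk0 : 0 < k := by
    rw [hk] at hpos
    exact pos_of_mul_pos_right hpos hp0.le
  have hk3 : k < 3 := by
    by_contra! h
    nlinarith [sq_nonneg (u - v)]
  obtain rfl | rfl : k = 1 ∨ k = 2 := by omega
  · exact ⟨u, v, by rw [hk, mul_one]⟩
  · have heven : Even (u ^ 2 + u * v + v ^ 2) := hk ▸ even_two.mul_left _
    have huv2 : Even u ∧ Even v := by
      simp only [Int.even_add, Int.even_mul, Int.even_pow] at heven
      tauto
    obtain ⟨⟨a, rfl⟩, ⟨b, rfl⟩⟩ := huv2
    have h2 : (p : ℤ) = 2 * (a ^ 2 + a * b + b ^ 2) := by linarith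
    omega

theorem bnum_of_even_exponents (n : ℕ) (hn : 0 < n)
    (h : ∀ p : ℕ, p.Prime → p ≠ 3 → p % 6 ≠ 1 → Even (n.factorization p)) :
    ∃ a b : ℕ, n = a^2 + a*b + b^2 := by
  apply exists_nat_of_mem_loeschianSubmonoid
  rw [← Nat.prod_factorization_pow_eq_self hn.ne', Finsupp.prod, Nat.cast_prod]
  refine prod_mem fun p hp => ?_
  have hprime : p.Prime := Nat.prime_of_mem_primeFactors hp
  rw [Nat.cast_pow]
  by_cases h3 : p = 3
  · subst h3
    exact pow_mem three_mem_loeschianSubmonoid _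
  by_cases h6 : p % 6 = 1
  · exact pow_mem (hprime.mem_loeschianSubmonoid h6) _
  · obtain ⟨k, hk⟩ := h p hprime h3 h6
    rw [hk, ← two_mul, pow_mul']
    exact sq_mem_loeschianSubmonoid _
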